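/- Let α ≥ 0, β ∈ ℝ, γ ≥ 0, and let ν : ℝ∖{0} → [0,∞) be a measurable function such that ∫_{ℝ∖{0}} min{1, x²} ν(x) dx < ∞ and such that x ↦ ν(x) and x ↦ ν(−x) are completely monotone on (0,∞). Define, for ξ ∈ ℝ, Ψ(ξ) = αξ² − iβξ + γ + ∫_{ℝ∖{0}} (1 − e^{iξx} + iξ(1 − e^{−|x|})·sign x) ν(x) dx (the Lévy–Khintchine exponent of a Lévy process with completely monotone jumps). Then Ψ extends to a Rogers function. -/

import Mathlib

open MeasureTheory Filter Set
open scoped ENNReal Topology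

noncomputable section

/-- A *Rogers function*: holomorphic on the right half-plane, with `Re (F z / z) ≥ 0` there. -/
def IsRogersFunction (F : ℂ → ℂ) : Prop :=
  DifferentiableOn ℂ F {z : ℂ | 0 < z.re} ∧ ∀ z : ℂ, 0 < z.re → 0 ≤ (F z / z).re

/-- `Ψ` extends to a Rogers function: some Rogers function agrees with `Ψ` on `(0, ∞)`. -/
def ExtendsToRogersFunction (Ψ : ℝ → ℂ) : Prop :=
  ∃ F : ℂ → ℂ, IsRogersFunction F ∧ ∀ ξ : ℝ, 0 < ξ → F (ξ : ℂ) = Ψ ξ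

/-- `f` is completely monotone on `(0, ∞)`. -/
def CompletelyMonotoneOn (f : ℝ → ℝ) : Prop :=
  (∀ n : ℕ, ContDiffOn ℝ n f (Set.Ioi 0)) ∧
  ∀ (n : ℕ) (x : ℝ), 0 < x → 0 ≤ (-1 : ℝ) ^ n * iteratedDerivWithin n f (Set.Ioi 0) x

/-- The Stieltjes-type denominator `p - i z (1 - p)`, as a continuous function of `p ∈ [0, 1]`. -/
def rogersDenom (z : ℂ) : C(unitInterval, ℂ) :=
  ⟨fun p => ((p : ℝ) : ℂ), by fun_prop⟩ -
    (Complex.I * z) • ⟨fun p => 1 - ((p : ℝ) : ℂ), by fun_prop⟩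

/-- The kernel `(z - i) / (p - i z (1 - p))`; after dividing by `z`, every Rogers function is a
mixture of such kernels over `p ∈ [0, 1]`. -/
def rogersKernel (z : ℂ) : C(unitInterval, ℂ) :=
  (z - Complex.I) • Ring.inverse (rogersDenom z)

lemma rogersDenom_apply (z : ℂ) (p : unitInterval) :
    rogersDenom z p = (p : ℝ) - Complex.I * z * (1 - (p : ℝ)) := rfl

lemma rogersDenom_apply_ne_zero {z : ℂ} (hz : 0 < z.re) (p : unitInterval) :
    rogersDenom z p ≠ 0 := by
  intro h
  rw [rogersDenom_apply] at h
  have him := congrArg Complex.im h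
  have hre := congrArg Complex.re h
  simp at him hre
  have hp : (p : ℝ) = 1 := by
    rcases him with him | him
    · exact absurd him hz.ne'
    · linarith
  rw [hp] at hre
  norm_num at hre

lemma isUnit_rogersDenom {z : ℂ} (hz : 0 < z.re) : IsUnit (rogersDenom z) :=
  (ContinuousMap.isUnit_iff_forall_ne_zero _).2 (rogersDenom_apply_ne_zero hz)

lemma rogersKernel_apply {z : ℂ} (hz : 0 < z.re) (p : unitInterval) :
    rogersKernel z p = (z - Complex.I) / ((p : ℝ) - Complex.I * z * (1 - (p : ℝ))) := by
  have h := DFunLike.congr_fun (Ring.inverse_mul_cancel _ (isUnit_rogersDenom hz)) p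
  rw [ContinuousMap.mul_apply, ContinuousMap.one_apply] at h
  rw [rogersKernel, ContinuousMap.smul_apply, smul_eq_mul, eq_inv_of_mul_eq_one_left h,
    rogersDenom_apply, div_eq_mul_inv]

lemma rogersKernel_re_nonneg {z : ℂ} (hz : 0 < z.re) (p : unitInterval) :
    0 ≤ (rogersKernel z p).re := by
  rw [rogersKernel_apply hz, Complex.div_re, ← add_div]
  refine div_nonneg ?_ (Complex.normSq_nonneg _)
  simp
  nlinarith [p.2.1, p.2.2]

lemma one_le_rogersKernel_one_re (p : unitInterval) : 1 ≤ (rogersKernel 1 p).re := by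
  have h0 := p.2.1
  have h1 := p.2.2
  rw [rogersKernel_apply (by simp), Complex.div_re, ← add_div]
  have hpos : (0 : ℝ) < p * p + (1 - p) * (1 - p) := by nlinarith [sq_nonneg (2 * (p : ℝ) - 1)]
  rw [Complex.normSq_apply]
  simp
  rw [one_le_inv₀ (by nlinarith)]
  nlinarith

lemma differentiableAt_rogersKernel {z : ℂ} (hz : 0 < z.re) :
    DifferentiableAt ℂ rogersKernel z := by
  have h : DifferentiableAt ℂ rogersDenom z := by
    unfold rogersDenom
    fun_prop
  have h1 : DifferentiableAt ℂ (fun w : ℂ => w - Complex.I) z := by fun_prop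
  exact h1.smul (h.inverse (isUnit_rogersDenom hz))

/-- `L` is nonnegative on functions with nonnegative real part. -/
def IsPositiveFunctional (L : WeakDual ℂ C(unitInterval, ℂ)) : Prop :=
  ∀ f : C(unitInterval, ℂ), (∀ p, 0 ≤ (f p).re) → 0 ≤ (L f).re

lemma IsPositiveFunctional.norm_apply_le {L : WeakDual ℂ C(unitInterval, ℂ)}
    (hL : IsPositiveFunctional L) (f : C(unitInterval, ℂ)) :
    ‖L f‖ ≤ (L (rogersKernel 1)).re * ‖f‖ := by
  obtain ⟨c, hc, hcf⟩ : ∃ c : ℂ, ‖c‖ = 1 ∧ c * L f = ‖L f‖ := by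
    obtain ⟨c, hc, h⟩ := RCLike.exists_norm_eq_mul_self (L f)
    exact ⟨c, hc, h.symm⟩
  have h := hL ((‖f‖ : ℂ) • rogersKernel 1 - c • f) fun p => by
    have h1 := one_le_rogersKernel_one_re p
    have h2 : (c * f p).re ≤ ‖f‖ :=
      (Complex.re_le_norm _).trans (by rw [norm_mul, hc, one_mul]; exact f.norm_coe_le_norm p)
    have h3 := norm_nonneg f
    simp only [ContinuousMap.sub_apply, ContinuousMap.smul_apply, smul_eq_mul, Complex.sub_re,
      Complex.re_ofReal_mul]
    nlinarith
  rw [map_sub, map_smul, map_smul, smul_eq_mul, smul_eq_mul, hcf, Complex.sub_re,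
    Complex.re_ofReal_mul, Complex.ofReal_re] at h
  linarith

/-- `Φ` is represented on `(0, ∞)` as `ξ ↦ ξ L(K_ξ)` with `L` positive and `K` the Rogers
kernel. -/
def HasRogersRepresentation (Φ : ℝ → ℂ) : Prop :=
  ∃ L : WeakDual ℂ C(unitInterval, ℂ), IsPositiveFunctional L ∧
    ∀ ξ : ℝ, 0 < ξ → Φ ξ = ξ * L (rogersKernel ξ)

lemma HasRogersRepresentation.extendsToRogersFunction {Φ : ℝ → ℂ}
    (h : HasRogersRepresentation Φ) : ExtendsToRogersFunction Φ := by
  obtain ⟨L, hL, hΦ⟩ := h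
  refine ⟨fun z => z * L (rogersKernel z), ⟨fun z hz => ?_, fun z hz => ?_⟩,
    fun ξ hξ => (hΦ ξ hξ).symm⟩
  · have hd : DifferentiableAt ℂ (fun w : ℂ => L (rogersKernel w)) z :=
      (WeakDual.toStrongDual L).differentiableAt.comp z (differentiableAt_rogersKernel hz)
    exact (differentiableAt_id.mul hd).differentiableWithinAt
  · have hz0 : z ≠ 0 := by
      rintro rfl
      simp at hz
    simp only [mul_div_cancel_left₀ _ hz0]
    exact hL _ (rogersKernel_re_nonneg hz)

lemma HasRogersRepresentation.zero : HasRogersRepresentation fun _ => 0 :=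
  ⟨0, fun _ _ => le_rfl, fun _ _ => (mul_zero _).symm⟩

lemma HasRogersRepresentation.add {Φ Θ : ℝ → ℂ} (hΦ : HasRogersRepresentation Φ)
    (hΘ : HasRogersRepresentation Θ) : HasRogersRepresentation fun ξ => Φ ξ + Θ ξ := by
  obtain ⟨L, hL, hLΦ⟩ := hΦ
  obtain ⟨M, hM, hMΘ⟩ := hΘ
  refine ⟨L + M, fun f hf => ?_, fun ξ hξ => ?_⟩
  · change 0 ≤ (L f + M f).re
    rw [Complex.add_re]
    exact add_nonneg (hL f hf) (hM f hf)
  · simp only [hLΦ ξ hξ, hMΘ ξ hξ]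
    exact (mul_add _ _ _).symm

lemma HasRogersRepresentation.const_mul {Φ : ℝ → ℂ} (hΦ : HasRogersRepresentation Φ) {c : ℝ}
    (hc : 0 ≤ c) : HasRogersRepresentation fun ξ => c * Φ ξ := by
  obtain ⟨L, hL, hLΦ⟩ := hΦ
  refine ⟨(c : ℂ) • L, fun f hf => ?_, fun ξ hξ => ?_⟩
  · change 0 ≤ ((c : ℂ) * L f).re
    rw [Complex.re_ofReal_mul]
    exact mul_nonneg hc (hL f hf)
  · simp only [hLΦ ξ hξ]
    exact mul_left_comm _ _ _

lemma HasRogersRepresentation.sum {ι : Type*} (s : Finset ι) {Φ : ι → ℝ → ℂ}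
    (h : ∀ i ∈ s, HasRogersRepresentation (Φ i)) :
    HasRogersRepresentation fun ξ => ∑ i ∈ s, Φ i ξ := by
  classical
  induction s using Finset.induction_on with
  | empty => simpa using HasRogersRepresentation.zero
  | insert i s hi ih =>
    simp only [Finset.sum_insert hi]
    exact (h i (Finset.mem_insert_self i s)).add
      (ih fun j hj => h j (Finset.mem_insert_of_mem hj))

/-- The representable functions are closed under pointwise limits (by Banach–Alaoglu). -/
lemma HasRogersRepresentation.of_tendsto {Φ : ℕ → ℝ → ℂ} {Θ : ℝ → ℂ}
    (h : ∀ n, HasRogersRepresentation (Φ n))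
    (hlim : ∀ ξ : ℝ, 0 < ξ → Tendsto (fun n => Φ n ξ) atTop (𝓝 (Θ ξ))) :
    HasRogersRepresentation Θ := by
  choose L hL hLΦ using h
  obtain ⟨R, hR⟩ : ∃ R, ∀ n, (L n (rogersKernel 1)).re ≤ R := by
    have hb := (Complex.continuous_re.tendsto _).comp (hlim 1 one_pos)
    obtain ⟨R, hR⟩ := hb.bddAbove_range
    refine ⟨R, fun n => ?_⟩
    have := hR (Set.mem_range_self n)
    simpa [hLΦ n 1 one_pos] using this
  have hmem : ∀ n, L n ∈ (WeakDual.toStrongDual ⁻¹'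
      Metric.closedBall (0 : StrongDual ℂ C(unitInterval, ℂ)) R) := fun n => by
    refine (mem_closedBall_zero_iff (E := StrongDual ℂ C(unitInterval, ℂ))).2 ?_
    have h0 : 0 ≤ (L n (rogersKernel 1)).re :=
      hL n _ (rogersKernel_re_nonneg (by simp))
    refine ContinuousLinearMap.opNorm_le_bound _ (h0.trans (hR n)) fun f => ?_
    exact ((hL n).norm_apply_le f).trans (mul_le_mul_of_nonneg_right (hR n) (norm_nonneg f))
  obtain ⟨M, -, hM⟩ := (WeakDual.isCompact_closedBall (𝕜 := ℂ)
    (0 : StrongDual ℂ C(unitInterval, ℂ)) R).ultrafilter_le_nhds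
      ((hyperfilter ℕ).map L)
        (le_principal_iff.2 (mem_map.2 (univ_mem' hmem)))
  have hev : ∀ f, Tendsto (fun n => L n f) (hyperfilter ℕ : Filter ℕ) (𝓝 (M f)) := fun f =>
    ((WeakDual.eval_continuous f).tendsto M).comp hM
  refine ⟨M, fun f hf => ?_, fun ξ hξ => ?_⟩
  · exact ge_of_tendsto' ((Complex.continuous_re.tendsto _).comp (hev f)) fun n => hL n f hf
  · have h1 := (hev (rogersKernel ξ)).const_mul (ξ : ℂ)
    have h2 : Tendsto (fun n => Φ n ξ) (hyperfilter ℕ : Filter ℕ) (𝓝 (Θ ξ)) :=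
      (hlim ξ hξ).mono_left Nat.hyperfilter_le_atTop
    refine tendsto_nhds_unique h2 (h1.congr fun n => (hLΦ n ξ hξ).symm)

/-- The compensated exponential kernel `1 - e^{iξx} + iξ(1 - e^{-x})`. -/
def levyKernel (ξ x : ℝ) : ℂ :=
  1 - Complex.exp (Complex.I * ξ * x) + Complex.I * ξ * ((1 - Real.exp (-x) : ℝ) : ℂ)

lemma continuous_levyKernel (ξ : ℝ) : Continuous (levyKernel ξ) := by
  unfold levyKernel
  fun_prop

lemma norm_levyKernel_le {ξ x : ℝ} (hξ : 0 < ξ) (hx : 0 < x) :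
    ‖levyKernel ξ x‖ ≤ (3 * ξ ^ 2 + ξ + 2) * min 1 (x ^ 2) := by
  have he : ‖1 - Complex.exp (Complex.I * ξ * x)‖ ≤ 2 := by
    refine (norm_sub_le _ _).trans ?_
    rw [show Complex.I * (ξ : ℂ) * x = ((ξ * x : ℝ) : ℂ) * Complex.I by push_cast; ring,
      Complex.norm_exp_ofReal_mul_I]
    norm_num
  have hnorm : ∀ r : ℝ, ‖Complex.I * ξ * (r : ℂ)‖ = ξ * |r| := fun r => by
    rw [norm_mul, norm_mul, Complex.norm_I, Complex.norm_real, Complex.norm_real,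
      Real.norm_eq_abs, Real.norm_eq_abs, abs_of_pos hξ, one_mul]
  have hexp1 : Real.exp (-x) ≤ 1 := Real.exp_le_one_iff.2 (by linarith)
  have hexp2 := Real.add_one_le_exp (-x)
  have habs : |1 - Real.exp (-x)| = 1 - Real.exp (-x) := abs_of_nonneg (by linarith)
  have hsplit : ‖levyKernel ξ x‖ ≤ 2 + ξ * (1 - Real.exp (-x)) := by
    unfold levyKernel
    refine (norm_add_le _ _).trans ?_
    rw [hnorm, habs]
    linarith
  have hpos := Real.exp_pos (-x)
  rcases le_total 1 (x ^ 2) with h1 | h1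
  · rw [min_eq_left h1]
    nlinarith [sq_nonneg ξ]
  rw [min_eq_right h1]
  have hx1 : x ≤ 1 := by nlinarith
  rcases le_total 1 (ξ * x) with h2 | h2
  · have h3 : 1 ≤ ξ ^ 2 * x ^ 2 := by nlinarith
    have h4 : ξ * x ≤ ξ ^ 2 * x ^ 2 := by nlinarith
    have h5 : ξ * (1 - Real.exp (-x)) ≤ ξ * x := by nlinarith
    nlinarith [sq_nonneg x]
  · have hA : ‖Complex.exp (Complex.I * ξ * x) - 1 - Complex.I * ξ * x‖ ≤ (ξ * x) ^ 2 := by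
      have hn : ‖Complex.I * ξ * x‖ = ξ * x := by rw [hnorm, abs_of_pos hx]
      have := Complex.norm_exp_sub_one_sub_id_le (x := Complex.I * ξ * x) (by rw [hn]; exact h2)
      rwa [hn] at this
    have hB : |Real.exp (-x) - 1 - (-x)| ≤ x ^ 2 := by
      simpa using Real.abs_exp_sub_one_sub_id_le (x := -x) (by rwa [abs_neg, abs_of_pos hx])
    have hsum : levyKernel ξ x = -(Complex.exp (Complex.I * ξ * x) - 1 - Complex.I * ξ * x) -
        Complex.I * ξ * ((Real.exp (-x) - 1 - (-x) : ℝ) : ℂ) := by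
      unfold levyKernel
      push_cast
      ring
    rw [hsum]
    refine (norm_sub_le _ _).trans ?_
    rw [norm_neg, hnorm]
    nlinarith [sq_nonneg (ξ * x), sq_nonneg x, mul_le_mul_of_nonneg_left hB hξ.le]

/-- The one-sided Lévy–Khintchine integral of a density `g` on `(0, ∞)`. -/
def levyIntegral (g : ℝ → ℝ) (ξ : ℝ) : ℂ :=
  ∫ x in Ioi (0 : ℝ), levyKernel ξ x * (g x : ℂ)

lemma integrableOn_levyKernel_mul_bound {b : ℝ → ℝ}
    (hb : IntegrableOn (fun x => min 1 (x ^ 2) * b x) (Ioi 0)) (ξ : ℝ) :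
    IntegrableOn (fun x => (3 * ξ ^ 2 + ξ + 2) * (min 1 (x ^ 2) * b x)) (Ioi 0) :=
  hb.const_mul _

lemma norm_levyKernel_mul_le {ξ x g b : ℝ} (hξ : 0 < ξ) (hx : 0 < x) (h : |g| ≤ b) :
    ‖levyKernel ξ x * (g : ℂ)‖ ≤ (3 * ξ ^ 2 + ξ + 2) * (min 1 (x ^ 2) * b) := by
  rw [norm_mul, Complex.norm_real, Real.norm_eq_abs, ← mul_assoc]
  exact mul_le_mul (norm_levyKernel_le hξ hx) h (abs_nonneg g)
    (mul_nonneg (by positivity) (le_min zero_le_one (sq_nonneg x)))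

lemma integrableOn_levyKernel_mul {g : ℝ → ℝ} (hg : Measurable g)
    (hnn : ∀ x, 0 < x → 0 ≤ g x)
    (hint : IntegrableOn (fun x => min 1 (x ^ 2) * g x) (Ioi 0)) {ξ : ℝ} (hξ : 0 < ξ) :
    IntegrableOn (fun x => levyKernel ξ x * (g x : ℂ)) (Ioi 0) := by
  refine Integrable.mono' (integrableOn_levyKernel_mul_bound hint ξ) ?_ ?_
  · exact ((continuous_levyKernel ξ).measurable.mul
      (Complex.measurable_ofReal.comp hg)).aestronglyMeasurable
  · filter_upwards [ae_restrict_mem measurableSet_Ioi] with x hx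
    exact norm_levyKernel_mul_le hξ hx (abs_of_nonneg (hnn x hx)).le

lemma HasRogersRepresentation.levyIntegral_of_tendsto {g : ℕ → ℝ → ℝ} {f b : ℝ → ℝ}
    (hg : ∀ n, Measurable (g n)) (hb : IntegrableOn (fun x => min 1 (x ^ 2) * b x) (Ioi 0))
    (hgb : ∀ n x, 0 < x → |g n x| ≤ b x)
    (hlim : ∀ x, 0 < x → Tendsto (fun n => g n x) atTop (𝓝 (f x)))
    (h : ∀ n, HasRogersRepresentation (levyIntegral (g n))) :
    HasRogersRepresentation (levyIntegral f) := by
  refine HasRogersRepresentation.of_tendsto h fun ξ hξ => ?_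
  refine tendsto_integral_of_dominated_convergence _ (fun n => ?_)
    (integrableOn_levyKernel_mul_bound hb ξ) (fun n => ?_) ?_
  · exact ((continuous_levyKernel ξ).measurable.mul
      (Complex.measurable_ofReal.comp (hg n))).aestronglyMeasurable
  · filter_upwards [ae_restrict_mem measurableSet_Ioi] with x hx
    exact norm_levyKernel_mul_le hξ hx (hgb n x hx)
  · filter_upwards [ae_restrict_mem measurableSet_Ioi] with x hx
    exact ((Complex.continuous_ofReal.tendsto _).comp (hlim x hx)).const_mul _

lemma integrableOn_min_mul_exp {s : ℝ} (hs : 0 < s) (c : ℝ) :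
    IntegrableOn (fun x : ℝ => min 1 (x ^ 2) * (c * Real.exp (-(s * x)))) (Ioi 0) := by
  have h1 : IntegrableOn (fun x : ℝ => |c| * Real.exp (-s * x)) (Ioi 0) :=
    (exp_neg_integrableOn_Ioi 0 hs).const_mul _
  refine Integrable.mono' h1 ?_ ?_
  · exact Continuous.aestronglyMeasurable (by fun_prop)
  · refine Eventually.of_forall fun x => ?_
    rw [norm_mul, norm_mul, Real.norm_eq_abs, Real.norm_eq_abs, Real.norm_eq_abs, Real.abs_exp,
      abs_of_nonneg (le_min zero_le_one (sq_nonneg x)), neg_mul]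
    exact mul_le_of_le_one_left (by positivity) (min_le_left _ _)

lemma levyIntegral_exp {s ξ : ℝ} (hs : 0 < s) :
    levyIntegral (fun x => Real.exp (-(s * x))) ξ =
      ξ * ((ξ - Complex.I) / (s * (s + 1) * (s - Complex.I * ξ))) := by
  have ha : ((-s : ℝ) : ℂ).re < 0 := by simpa using hs
  have hb : (Complex.I * ξ - (s : ℂ)).re < 0 := by simpa using hs
  have hc : ((-s - 1 : ℝ) : ℂ).re < 0 := by rw [Complex.ofReal_re]; linarith
  have hia := integrableOn_exp_mul_complex_Ioi ha 0
  have hib := integrableOn_exp_mul_complex_Ioi hb 0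
  have hic := integrableOn_exp_mul_complex_Ioi hc 0
  have hEq : ∀ x : ℝ, levyKernel ξ x * ((Real.exp (-(s * x)) : ℝ) : ℂ) =
      (1 + Complex.I * ξ) * Complex.exp (((-s : ℝ) : ℂ) * x) -
        Complex.exp ((Complex.I * ξ - (s : ℂ)) * x) -
        Complex.I * ξ * Complex.exp (((-s - 1 : ℝ) : ℂ) * x) := fun x => by
    have e1 : Complex.exp ((Complex.I * ξ - (s : ℂ)) * x) =
        Complex.exp (Complex.I * ξ * x) * Complex.exp (((-s : ℝ) : ℂ) * x) := by
      rw [← Complex.exp_add]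
      congr 1
      push_cast
      ring
    have e2 : Complex.exp (((-s - 1 : ℝ) : ℂ) * x) =
        Complex.exp (-x) * Complex.exp (((-s : ℝ) : ℂ) * x) := by
      rw [← Complex.exp_add]
      congr 1
      push_cast
      ring
    rw [levyKernel, e1, e2]
    push_cast
    rw [neg_mul]
    ring
  simp only [levyIntegral, hEq]
  rw [integral_sub, integral_sub, integral_const_mul, integral_const_mul,
    integral_exp_mul_complex_Ioi ha, integral_exp_mul_complex_Ioi hb,
    integral_exp_mul_complex_Ioi hc]
  · have h1 : (s : ℂ) ≠ 0 := by exact_mod_cast hs.ne'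
    have h2 : (s : ℂ) + 1 ≠ 0 := by exact_mod_cast (by linarith : s + 1 ≠ 0)
    have h3 : (s : ℂ) - Complex.I * ξ ≠ 0 := fun h => by
      have := congrArg Complex.re h
      simp at this
      exact hs.ne' this
    have h4 : Complex.I * ξ - (s : ℂ) ≠ 0 := fun h => h3 (by linear_combination -h)
    have h5 : (-s : ℂ) - 1 ≠ 0 := fun h => h2 (by linear_combination -h)
    push_cast
    simp only [mul_zero, Complex.exp_zero]
    have e4 : Complex.I * ξ - (s : ℂ) = -((s : ℂ) - Complex.I * ξ) := by ring
    have e5 : (-s : ℂ) - 1 = -((s : ℂ) + 1) := by ring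
    rw [e4, e5]
    field_simp
    ring_nf
    simp only [Complex.I_sq]
    ring
  · exact hia.const_mul _
  · exact hib
  · exact (hia.const_mul _).sub hib
  · exact hic.const_mul _

lemma hasRogersRepresentation_levyIntegral_exp {s : ℝ} (hs : 0 < s) :
    HasRogersRepresentation (levyIntegral fun x => Real.exp (-(s * x))) := by
  have hp : s / (s + 1) ∈ unitInterval :=
    ⟨by positivity, (div_le_one (by linarith)).2 (by linarith)⟩
  refine ⟨((1 / (s * (s + 1) ^ 2) : ℝ) : ℂ) •
    StrongDual.toWeakDual (ContinuousMap.evalCLM ℂ (⟨_, hp⟩ : unitInterval)), fun f hf => ?_,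
    fun ξ hξ => ?_⟩
  · change 0 ≤ (((1 / (s * (s + 1) ^ 2) : ℝ) : ℂ) * f ⟨_, hp⟩).re
    rw [Complex.re_ofReal_mul]
    exact mul_nonneg (by positivity) (hf _)
  · rw [levyIntegral_exp hs]
    change _ = _ * (((1 / (s * (s + 1) ^ 2) : ℝ) : ℂ) * rogersKernel ξ ⟨_, hp⟩)
    congr 1
    rw [rogersKernel_apply (by simpa using hξ)]
    have h1 : (s : ℂ) ≠ 0 := by exact_mod_cast hs.ne'
    have h2 : (s : ℂ) + 1 ≠ 0 := by exact_mod_cast (by linarith : s + 1 ≠ 0)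
    have h3 : (s : ℂ) - Complex.I * ξ ≠ 0 := fun h => by
      have := congrArg Complex.re h
      simp at this
      exact hs.ne' this
    have h4 : ((s / (s + 1) : ℝ) : ℂ) - Complex.I * ξ * (1 - ((s / (s + 1) : ℝ) : ℂ)) =
        (s - Complex.I * ξ) / (s + 1) := by
      push_cast
      field_simp
      ring
    rw [h4]
    push_cast
    field_simp

lemma le_of_hasDerivAt_nonneg {f f' : ℝ → ℝ} {a b : ℝ} (hab : a ≤ b)
    (h : ∀ x ∈ Icc a b, HasDerivAt f (f' x) x) (h' : ∀ x ∈ Icc a b, 0 ≤ f' x) : f a ≤ f b := by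
  have hm : MonotoneOn f (Icc a b) :=
    monotoneOn_of_hasDerivWithinAt_nonneg (convex_Icc a b)
      (fun x hx => (h x hx).continuousAt.continuousWithinAt)
      (fun x hx => (h x (interior_subset hx)).hasDerivWithinAt)
      (fun x hx => h' x (interior_subset hx))
  exact hm (left_mem_Icc.2 hab) (right_mem_Icc.2 hab) hab

/-- The Taylor remainder of order `n` at `0` of `H 0`, where `H k` plays the role of the `k`-th
derivative. -/
def taylorRemainder (H : ℕ → ℝ → ℝ) (n : ℕ) (v : ℝ) : ℝ :=
  H 0 v - ∑ k ∈ Finset.range n, H k 0 * v ^ k / k.factorial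

lemma hasDerivAt_taylorRemainder_succ {H : ℕ → ℝ → ℝ} (n : ℕ) {v : ℝ}
    (h : HasDerivAt (H 0) (H 1 v) v) :
    HasDerivAt (taylorRemainder H (n + 1)) (taylorRemainder (fun k => H (k + 1)) n v) v := by
  refine HasDerivAt.sub (by simpa using h) ?_
  have hs : (fun v : ℝ => ∑ k ∈ Finset.range (n + 1), H k 0 * v ^ k / k.factorial) =
      fun v : ℝ => ∑ k ∈ Finset.range n, H (k + 1) 0 * v ^ (k + 1) / (k + 1).factorial +
        H 0 0 := by
    ext v
    rw [Finset.sum_range_succ']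
    simp
  rw [hs]
  refine HasDerivAt.add_const _ (HasDerivAt.fun_sum fun k _ => ?_)
  have hd := ((hasDerivAt_pow (k + 1) v).const_mul (H (k + 1) 0)).div_const
    ((k + 1).factorial : ℝ)
  refine hd.congr_deriv ?_
  rw [Nat.factorial_succ]
  push_cast
  have h1 : (k.factorial : ℝ) ≠ 0 := by positivity
  have h2 : (k : ℝ) + 1 ≠ 0 := by positivity
  field_simp

lemma taylorRemainder_succ_zero (H : ℕ → ℝ → ℝ) (n : ℕ) : taylorRemainder H (n + 1) 0 = 0 := by
  rw [taylorRemainder, Finset.sum_range_succ']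
  simp

/-- If all derivatives are nonnegative on `[0, T)`, the Taylor remainders are nonnegative and
`v ↦ R_n(v) / v ^ n` is nondecreasing. -/
lemma taylorRemainder_nonneg_and_mul_pow_le {T : ℝ} (n : ℕ) : ∀ {H : ℕ → ℝ → ℝ},
    (∀ k v, 0 ≤ v → v < T → HasDerivAt (H k) (H (k + 1) v) v) →
    (∀ k v, 0 ≤ v → v < T → 0 ≤ H k v) →
    (∀ v, 0 ≤ v → v < T → 0 ≤ taylorRemainder H n v) ∧
    ∀ v w, 0 ≤ v → v ≤ w → w < T →
      taylorRemainder H n v * w ^ n ≤ taylorRemainder H n w * v ^ n := by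
  induction n with
  | zero =>
    intro H hH hnn
    refine ⟨fun v h0 hT => by simpa [taylorRemainder] using hnn 0 v h0 hT, fun v w h0 hvw hT => ?_⟩
    simpa [taylorRemainder] using le_of_hasDerivAt_nonneg hvw
      (fun x hx => hH 0 x (h0.trans hx.1) (hx.2.trans_lt hT))
      (fun x hx => hnn 1 x (h0.trans hx.1) (hx.2.trans_lt hT))
  | succ n ih =>
    intro H hH hnn
    obtain ⟨ih1, ih2⟩ := @ih (fun k => H (k + 1)) (fun k => hH (k + 1)) fun k => hnn (k + 1)
    have hd : ∀ v, 0 ≤ v → v < T → HasDerivAt (taylorRemainder H (n + 1))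
        (taylorRemainder (fun k => H (k + 1)) n v) v := fun v h0 hT =>
      hasDerivAt_taylorRemainder_succ n (hH 0 v h0 hT)
    refine ⟨fun v h0 hT => ?_, fun v w h0 hvw hT => ?_⟩
    · rw [← taylorRemainder_succ_zero H n]
      exact le_of_hasDerivAt_nonneg h0
        (fun x hx => hd x hx.1 (hx.2.trans_lt hT))
        (fun x hx => ih1 x hx.1 (hx.2.trans_lt hT))
    · have hw : 0 ≤ w := h0.trans hvw
      have hu : ∀ u ∈ Icc (0 : ℝ) 1, ∀ y, 0 ≤ y → y < T → 0 ≤ y * u ∧ y * u < T :=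
        fun u hu y hy hyT => ⟨mul_nonneg hy hu.1, (mul_le_of_le_one_right hy hu.2).trans_lt hyT⟩
      have hcomp : ∀ u ∈ Icc (0 : ℝ) 1, ∀ y, 0 ≤ y → y < T →
          HasDerivAt (fun u => taylorRemainder H (n + 1) (y * u))
            (taylorRemainder (fun k => H (k + 1)) n (y * u) * y) u := fun u h y hy hyT => by
        have h1 : HasDerivAt (fun u : ℝ => y * u) y u := by
          simpa using (hasDerivAt_id u).const_mul y
        exact (hd _ (hu u h y hy hyT).1 (hu u h y hy hyT).2).comp u h1
      have key := le_of_hasDerivAt_nonneg (a := 0) (b := 1)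
        (f := fun u => taylorRemainder H (n + 1) (w * u) * v ^ (n + 1) -
          taylorRemainder H (n + 1) (v * u) * w ^ (n + 1))
        zero_le_one
        (fun u h => ((hcomp u h w hw hT).mul_const _).sub
          ((hcomp u h v h0 (hvw.trans_lt hT)).mul_const _))
        (fun u h => by
          rcases h.1.eq_or_lt with rfl | hpos
          · simp only [mul_zero]
            rcases n with _ | n
            · simp only [zero_add, pow_one]
              linarith
            · rw [taylorRemainder_succ_zero]
              simp
          · have hle := ih2 (v * u) (w * u) (mul_nonneg h0 h.1)
              (mul_le_mul_of_nonneg_right hvw h.1) (hu u h w hw hT).2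
            rw [mul_pow, mul_pow, ← mul_assoc, ← mul_assoc] at hle
            have hle' := le_of_mul_le_mul_right hle (pow_pos hpos n)
            have := mul_le_mul_of_nonneg_left hle' (mul_nonneg h0 hw)
            rw [pow_succ, pow_succ]
            nlinarith)
      simp only [mul_zero, mul_one, taylorRemainder_succ_zero, zero_mul, sub_zero] at key
      linarith

/-- S. Bernstein: a function with nonnegative derivatives is the sum of its Taylor series. -/
lemma hasSum_taylor_of_derivatives_nonneg {T : ℝ} {H : ℕ → ℝ → ℝ}
    (hH : ∀ k v, 0 ≤ v → v < T → HasDerivAt (H k) (H (k + 1) v) v)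
    (hnn : ∀ k v, 0 ≤ v → v < T → 0 ≤ H k v) {v w : ℝ} (hv : 0 ≤ v) (hvw : v < w) (hw : w < T) :
    HasSum (fun k => H k 0 * v ^ k / k.factorial) (H 0 v) := by
  have h0w : 0 < w := hv.trans_lt hvw
  have hterm : ∀ k, ∀ y, 0 ≤ y → 0 ≤ H k 0 * y ^ k / k.factorial := fun k y hy =>
    div_nonneg (mul_nonneg (hnn k 0 le_rfl (h0w.trans hw)) (pow_nonneg hy k)) (by positivity)
  rw [hasSum_iff_tendsto_nat_of_nonneg fun k => hterm k v hv]
  have hR : Tendsto (fun n => taylorRemainder H n v) atTop (𝓝 0) := by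
    refine squeeze_zero (g := fun n => H 0 w * (v / w) ^ n)
      (fun n => (taylorRemainder_nonneg_and_mul_pow_le n hH hnn).1 v hv (hvw.trans hw))
      (fun n => ?_) ?_
    · have h1 := (taylorRemainder_nonneg_and_mul_pow_le n hH hnn).2 v w hv hvw.le hw
      have h2 : taylorRemainder H n w ≤ H 0 w :=
        sub_le_self _ (Finset.sum_nonneg fun k _ => hterm k w h0w.le)
      rw [div_pow, mul_div_assoc', le_div_iff₀ (pow_pos h0w n)]
      exact h1.trans (mul_le_mul_of_nonneg_right h2 (pow_nonneg hv n))
    · simpa using (tendsto_pow_atTop_nhds_zero_of_lt_one (div_nonneg hv h0w.le)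
        ((div_lt_one h0w).2 hvw)).const_mul (H 0 w)
  simpa [taylorRemainder] using hR.const_sub (H 0 v)

lemma CompletelyMonotoneOn.hasDerivAt {f : ℝ → ℝ} (hf : CompletelyMonotoneOn f) (k : ℕ) {x : ℝ}
    (hx : 0 < x) :
    HasDerivAt (fun y => (-1 : ℝ) ^ k * iteratedDerivWithin k f (Ioi 0) y)
      (-((-1 : ℝ) ^ (k + 1) * iteratedDerivWithin (k + 1) f (Ioi 0) x)) x := by
  have hd : DifferentiableOn ℝ (iteratedDerivWithin k f (Ioi 0)) (Ioi 0) :=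
    (hf.1 (k + 1)).differentiableOn_iteratedDerivWithin (by exact_mod_cast k.lt_succ_self)
      (uniqueDiffOn_Ioi 0)
  have h1 := ((hd x hx).hasDerivWithinAt.hasDerivAt (Ioi_mem_nhds hx)).const_mul ((-1 : ℝ) ^ k)
  rw [← iteratedDerivWithin_succ] at h1
  exact h1.congr_deriv (by ring)

lemma CompletelyMonotoneOn.continuousOn {f : ℝ → ℝ} (hf : CompletelyMonotoneOn f) :
    ContinuousOn f (Ioi 0) :=
  (hf.1 0).continuousOn

lemma CompletelyMonotoneOn.antitoneOn {f : ℝ → ℝ} (hf : CompletelyMonotoneOn f) :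
    AntitoneOn f (Ioi 0) := by
  intro x hx y hy hxy
  have h := le_of_hasDerivAt_nonneg (f := fun t => -f t) hxy
    (fun t ht => by simpa using (hf.hasDerivAt 0 (lt_of_lt_of_le hx ht.1)).fun_neg)
    (fun t ht => by simpa using hf.2 1 t (lt_of_lt_of_le hx ht.1))
  simpa using h

/-- A completely monotone function is a power series in `1 - x / T` with nonnegative
coefficients. -/
lemma CompletelyMonotoneOn.exists_hasSum {f : ℝ → ℝ} (hf : CompletelyMonotoneOn f) {δ T : ℝ}
    (hδ : 0 < δ) (hT : 0 < T) :
    ∃ c : ℕ → ℝ, (∀ k, 0 ≤ c k) ∧ HasSum c (f δ) ∧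
      ∀ x, 0 ≤ x → x ≤ T → HasSum (fun k => c k * (1 - x / T) ^ k) (f (δ + x)) := by
  set H : ℕ → ℝ → ℝ := fun k v =>
    (-1 : ℝ) ^ k * iteratedDerivWithin k f (Ioi 0) (δ + T - v) with hHdef
  have hnn : ∀ k v, 0 ≤ v → v < δ + T → 0 ≤ H k v := fun k v _ hv =>
    hf.2 k _ (by linarith)
  have hH : ∀ k v, 0 ≤ v → v < δ + T → HasDerivAt (H k) (H (k + 1) v) v := fun k v _ hv => by
    have h1 : HasDerivAt (fun v : ℝ => δ + T - v) (-1) v := (hasDerivAt_id v).const_sub _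
    have h2 := HasDerivAt.comp v (hf.hasDerivAt k (x := δ + T - v) (by linarith)) h1
    exact h2.congr_deriv (by ring)
  have hsum : ∀ x, 0 ≤ x → x ≤ T →
      HasSum (fun k => H k 0 * T ^ k / k.factorial * (1 - x / T) ^ k) (f (δ + x)) :=
    fun x h0 h1 => by
      have := hasSum_taylor_of_derivatives_nonneg hH hnn (v := T - x) (w := δ / 2 + T)
        (by linarith) (by linarith) (by linarith)
      convert this using 1
      · ext k
        rw [show T - x = T * (1 - x / T) by field_simp, mul_pow]
        ring
      · simp only [hHdef, pow_zero, one_mul, iteratedDerivWithin_zero]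
        congr 1
        ring
  refine ⟨fun k => H k 0 * T ^ k / k.factorial, fun k => ?_, ?_, hsum⟩
  · exact div_nonneg (mul_nonneg (hnn k 0 le_rfl (by linarith)) (by positivity)) (by positivity)
  · simpa using hsum 0 le_rfl hT.le

lemma hasRogersRepresentation_levyIntegral_sum {c s : ℕ → ℝ} (hc : ∀ k, 0 ≤ c k)
    (hs : ∀ k, 0 < s k) (N : ℕ) :
    HasRogersRepresentation
      (levyIntegral fun x => ∑ k ∈ Finset.range N, c k * Real.exp (-(s k * x))) := by
  obtain ⟨L, hL, hLΦ⟩ := HasRogersRepresentation.sum (Finset.range N) fun k _ =>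
    (hasRogersRepresentation_levyIntegral_exp (hs k)).const_mul (hc k)
  refine ⟨L, hL, fun ξ hξ => ?_⟩
  rw [← hLΦ ξ hξ]
  simp only [levyIntegral, ← integral_const_mul]
  rw [← integral_finsetSum]
  · refine integral_congr_ae (Eventually.of_forall fun x => ?_)
    simp only
    push_cast
    rw [Finset.mul_sum]
    exact Finset.sum_congr rfl fun k _ => by ring
  · intro k _
    refine Integrable.const_mul (integrableOn_levyKernel_mul
      (g := fun x => Real.exp (-(s k * x))) (by fun_prop) (fun x _ => (Real.exp_pos _).le) ?_ hξ) _
    simpa using integrableOn_min_mul_exp (hs k) 1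

lemma hasRogersRepresentation_levyIntegral_tsum {c : ℕ → ℝ} {M h η : ℝ} (hc : ∀ k, 0 ≤ c k)
    (hM : HasSum c M) (hh : 0 ≤ h) (hη : 0 < η) :
    HasRogersRepresentation (levyIntegral fun x =>
      (∑' k, c k * Real.exp (-(h * |x|)) ^ k) * Real.exp (-(η * x))) := by
  refine HasRogersRepresentation.levyIntegral_of_tendsto
    (g := fun N x => ∑ k ∈ Finset.range N, c k * Real.exp (-((k * h + η) * x)))
    (b := fun x => M * Real.exp (-(η * x))) (fun N => by fun_prop)
    (integrableOn_min_mul_exp hη M) ?_ ?_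
    (hasRogersRepresentation_levyIntegral_sum hc fun k => by positivity)
  · intro N x hx
    rw [abs_of_nonneg (Finset.sum_nonneg fun k _ => mul_nonneg (hc k) (Real.exp_pos _).le)]
    refine le_trans (Finset.sum_le_sum (g := fun k => c k * Real.exp (-(η * x))) fun k _ => ?_) ?_
    · refine mul_le_mul_of_nonneg_left (Real.exp_le_exp.2 ?_) (hc k)
      have : 0 ≤ k * h * x := by positivity
      linarith
    · rw [← Finset.sum_mul]
      exact mul_le_mul_of_nonneg_right (sum_le_hasSum _ (fun k _ => hc k) hM) (Real.exp_pos _).le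
  · intro x hx
    have hle : Real.exp (-(h * |x|)) ≤ 1 :=
      Real.exp_le_one_iff.2 (neg_nonpos.2 (mul_nonneg hh (abs_nonneg x)))
    have hsum : Summable fun k => c k * Real.exp (-(h * |x|)) ^ k :=
      Summable.of_nonneg_of_le
        (fun k => mul_nonneg (hc k) (pow_nonneg (Real.exp_pos _).le k))
        (fun k => mul_le_of_le_one_right (hc k) (pow_le_one₀ (Real.exp_pos _).le hle)) hM.summable
    refine (hsum.hasSum.tendsto_sum_nat.mul_const (Real.exp (-(η * x)))).congr fun N => ?_
    rw [Finset.sum_mul]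
    refine Finset.sum_congr rfl fun k _ => ?_
    rw [mul_assoc, ← Real.exp_nat_mul, ← Real.exp_add, abs_of_pos hx]
    congr 2
    ring

lemma pow_sub_pow_le_div {p q : ℝ} (hq : 0 ≤ q) (hqp : q ≤ p) (hp : p < 1) (k : ℕ) :
    p ^ k - q ^ k ≤ (p - q) / (1 - p) := by
  have h1p : 0 < 1 - p := by linarith
  induction k with
  | zero =>
    simp only [pow_zero, sub_self]
    exact div_nonneg (by linarith) h1p.le
  | succ k ih =>
    have hqk : q ^ k ≤ 1 := pow_le_one₀ hq (by linarith)
    have hC : (p - q) / (1 - p) * (1 - p) = p - q := div_mul_cancel₀ _ h1p.ne'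
    have h2 := mul_le_mul_of_nonneg_left ih (hq.trans hqp)
    have h3 := mul_le_mul_of_nonneg_right hqk (sub_nonneg.2 hqp)
    calc p ^ (k + 1) - q ^ (k + 1) = p * (p ^ k - q ^ k) + q ^ k * (p - q) := by ring
      _ ≤ p * ((p - q) / (1 - p)) + 1 * (p - q) := add_le_add h2 h3
      _ = (p - q) / (1 - p) := by linear_combination -hC

lemma abs_exp_neg_pow_sub_le {u : ℝ} (hu : 0 < u) (hu1 : u ≤ 1 / 2) (k : ℕ) :
    |Real.exp (-u) ^ k - (1 - u) ^ k| ≤ 2 * u := by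
  have h1 := Real.one_sub_le_exp_neg u
  have h2 : Real.exp (-u) - (1 - u) ≤ u ^ 2 := by
    have := le_of_abs_le (Real.abs_exp_sub_one_sub_id_le (x := -u) (by
      rw [abs_neg, abs_of_pos hu]; linarith))
    nlinarith
  have h3 : Real.exp (-u) < 1 := Real.exp_lt_one_iff.2 (by linarith)
  rw [abs_of_nonneg (sub_nonneg.2 (pow_le_pow_left₀ (by linarith) h1 k))]
  refine (pow_sub_pow_le_div (by linarith) h1 h3 k).trans ?_
  rw [div_le_iff₀ (by linarith)]
  nlinarith

lemma CompletelyMonotoneOn.nonneg {f : ℝ → ℝ} (hf : CompletelyMonotoneOn f) {x : ℝ}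
    (hx : 0 < x) : 0 ≤ f x := by
  simpa using hf.2 0 x hx

lemma CompletelyMonotoneOn.hasRogersRepresentation_shift {f : ℝ → ℝ}
    (hf : CompletelyMonotoneOn f) {δ : ℝ} (hδ : 0 < δ) :
    HasRogersRepresentation (levyIntegral fun x => f (δ + x) * Real.exp (-(δ * x))) := by
  choose c hc hcM hcf using fun n : ℕ => hf.exists_hasSum hδ (T := n + 1) (by positivity)
  have hM := hf.nonneg hδ
  have hbd : ∀ (n k : ℕ) (x : ℝ), ‖c n k * Real.exp (-(1 / (n + 1) * |x|)) ^ k‖ ≤ c n k :=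
    fun n k x => by
      have hle : Real.exp (-(1 / (n + 1) * |x|)) ≤ 1 :=
        Real.exp_le_one_iff.2 (neg_nonpos.2 (by positivity))
      rw [Real.norm_of_nonneg (mul_nonneg (hc n k) (pow_nonneg (Real.exp_pos _).le k))]
      exact mul_le_of_le_one_right (hc n k) (pow_le_one₀ (Real.exp_pos _).le hle)
  have hsum : ∀ (n : ℕ) (x : ℝ), Summable fun k => c n k * Real.exp (-(1 / (n + 1) * |x|)) ^ k :=
    fun n x => Summable.of_norm_bounded (hcM n).summable fun k => hbd n k x
  refine HasRogersRepresentation.levyIntegral_of_tendsto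
    (g := fun n x =>
      (∑' k, c n k * Real.exp (-(1 / (n + 1) * |x|)) ^ k) * Real.exp (-(δ * x)))
    (b := fun x => f δ * Real.exp (-(δ * x))) (fun n => ?_)
    (integrableOn_min_mul_exp hδ (f δ)) (fun n x hx => ?_) (fun x hx => ?_)
    (fun n => hasRogersRepresentation_levyIntegral_tsum (hc n) (hcM n) (by positivity) hδ)
  · have : Continuous fun x : ℝ => ∑' k, c n k * Real.exp (-(1 / (n + 1) * |x|)) ^ k :=
      continuous_tsum (fun k => by fun_prop) (hcM n).summable fun k x => hbd n k x
    exact (this.mul (by fun_prop)).measurable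
  · rw [abs_mul, Real.abs_exp]
    refine mul_le_mul_of_nonneg_right ?_ (Real.exp_pos _).le
    exact tsum_of_norm_bounded (hcM n) fun k => hbd n k x
  · refine Tendsto.mul_const _ ?_
    rw [tendsto_iff_dist_tendsto_zero]
    have hlim : Tendsto (fun n : ℕ => 2 * x * f δ * (1 / ((n : ℝ) + 1))) atTop (𝓝 0) := by
      simpa using tendsto_one_div_add_atTop_nhds_zero_nat.const_mul (2 * x * f δ)
    refine squeeze_zero' (Eventually.of_forall fun _ => dist_nonneg) ?_ hlim
    filter_upwards [eventually_ge_atTop ⌈2 * x⌉₊] with n hn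
    have hn1 : (0 : ℝ) < n + 1 := by positivity
    have hn2 : 2 * x ≤ n := (Nat.le_ceil _).trans (by exact_mod_cast hn)
    have hu : x / (n + 1) ≤ 1 / 2 := by
      rw [div_le_iff₀ hn1]
      linarith
    have hfx := hcf n x hx.le (by linarith)
    rw [dist_eq_norm, ← hfx.tsum_eq, ← (hsum n x).tsum_sub hfx.summable]
    have hb : HasSum (fun k => c n k * (2 * (x / (n + 1)))) (f δ * (2 * (x / (n + 1)))) :=
      (hcM n).mul_right _
    have hfin : f δ * (2 * (x / (n + 1))) = 2 * x * f δ * (1 / (n + 1)) := by ring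
    rw [← hfin]
    refine tsum_of_norm_bounded hb fun k => ?_
    rw [← mul_sub, Real.norm_eq_abs, abs_mul, abs_of_nonneg (hc n k), abs_of_pos hx,
      one_div_mul_eq_div]
    exact mul_le_mul_of_nonneg_left (abs_exp_neg_pow_sub_le (by positivity) hu k) (hc n k)

lemma CompletelyMonotoneOn.hasRogersRepresentation {f : ℝ → ℝ} (hf : CompletelyMonotoneOn f)
    (hmeas : Measurable f) (hint : IntegrableOn (fun x => min 1 (x ^ 2) * f x) (Ioi 0)) :
    HasRogersRepresentation (levyIntegral f) := by
  have hδ : ∀ n : ℕ, (0 : ℝ) < 1 / ((n : ℝ) + 1) := fun n => by positivity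
  refine HasRogersRepresentation.levyIntegral_of_tendsto
    (g := fun n x => f (1 / (n + 1) + x) * Real.exp (-(1 / (n + 1) * x)))
    (fun n => (hmeas.comp (by fun_prop)).mul (by fun_prop)) hint (fun n x hx => ?_)
    (fun x hx => ?_) fun n => hf.hasRogersRepresentation_shift (hδ n)
  · have hpos : 0 < 1 / ((n : ℝ) + 1) + x := add_pos (hδ n) hx
    rw [abs_mul, Real.abs_exp, abs_of_nonneg (hf.nonneg hpos)]
    refine (mul_le_of_le_one_right (hf.nonneg hpos) ?_).trans
      (hf.antitoneOn hx hpos (by linarith [hδ n]))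
    exact Real.exp_le_one_iff.2 (neg_nonpos.2 (mul_pos (hδ n) hx).le)
  · have h0 : Tendsto (fun n : ℕ => 1 / ((n : ℝ) + 1)) atTop (𝓝 0) :=
      tendsto_one_div_add_atTop_nhds_zero_nat
    have h1 : Tendsto (fun n : ℕ => f (1 / ((n : ℝ) + 1) + x)) atTop (𝓝 (f x)) := by
      have hc : ContinuousAt f x := hf.continuousOn.continuousAt (Ioi_mem_nhds hx)
      exact hc.tendsto.comp (by simpa using h0.add_const x)
    have h2 : Tendsto (fun n : ℕ => Real.exp (-(1 / ((n : ℝ) + 1) * x))) atTop (𝓝 1) := by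
      have := (Real.continuous_exp.tendsto _).comp (h0.mul_const x).neg
      simpa [Function.comp_def] using this
    simpa using h1.mul h2

lemma ExtendsToRogersFunction.add {Φ Θ : ℝ → ℂ} (hΦ : ExtendsToRogersFunction Φ)
    (hΘ : ExtendsToRogersFunction Θ) : ExtendsToRogersFunction fun ξ => Φ ξ + Θ ξ := by
  obtain ⟨F, ⟨hF, hF'⟩, hFΦ⟩ := hΦ
  obtain ⟨G, ⟨hG, hG'⟩, hGΘ⟩ := hΘ
  refine ⟨fun z => F z + G z, ⟨hF.add hG, fun z hz => ?_⟩, fun ξ hξ => ?_⟩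
  · rw [add_div, Complex.add_re]
    exact add_nonneg (hF' z hz) (hG' z hz)
  · simp only [hFΦ ξ hξ, hGΘ ξ hξ]

lemma ExtendsToRogersFunction.conj {Φ : ℝ → ℂ} (hΦ : ExtendsToRogersFunction Φ) :
    ExtendsToRogersFunction fun ξ => (starRingEnd ℂ) (Φ ξ) := by
  obtain ⟨F, ⟨hF, hF'⟩, hFΦ⟩ := hΦ
  refine ⟨fun z => (starRingEnd ℂ) (F ((starRingEnd ℂ) z)),
    ⟨fun z hz => ?_, fun z hz => ?_⟩, fun ξ hξ => ?_⟩
  · have hz' : 0 < ((starRingEnd ℂ) z).re := by simpa using hz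
    have hd : DifferentiableAt ℂ F ((starRingEnd ℂ) z) :=
      (hF _ hz').differentiableAt ((isOpen_lt continuous_const Complex.continuous_re).mem_nhds hz')
    have h := hd.hasDerivAt.conj_conj
    rw [Complex.conj_conj] at h
    exact h.differentiableAt.differentiableWithinAt
  · have h := hF' ((starRingEnd ℂ) z) (by simpa using hz)
    rw [← Complex.conj_re, map_div₀, Complex.conj_conj] at h
    exact h
  · simp only [Complex.conj_ofReal, hFΦ ξ hξ]

lemma extendsToRogersFunction_quadratic {α γ : ℝ} (β : ℝ) (hα : 0 ≤ α) (hγ : 0 ≤ γ) :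
    ExtendsToRogersFunction fun ξ : ℝ =>
      (α : ℂ) * (ξ : ℂ) ^ 2 - Complex.I * (β : ℂ) * (ξ : ℂ) + (γ : ℂ) := by
  refine ⟨fun z => α * z ^ 2 - Complex.I * β * z + γ,
    ⟨by fun_prop, fun z hz => ?_⟩, fun ξ _ => rfl⟩
  have hz0 : z ≠ 0 := by
    rintro rfl
    simp at hz
  have h : (α * z ^ 2 - Complex.I * β * z + γ) / z = α * z - Complex.I * β + γ * z⁻¹ := by
    field_simp
  rw [h]
  have hinv : 0 ≤ (z⁻¹).re := by
    rw [Complex.inv_re]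
    exact div_nonneg hz.le (Complex.normSq_nonneg z)
  simp only [Complex.add_re, Complex.sub_re, Complex.re_ofReal_mul, Complex.re_mul_ofReal,
    Complex.I_re, zero_mul, sub_zero]
  positivity

lemma conj_levyKernel (ξ x : ℝ) : (starRingEnd ℂ) (levyKernel ξ x) =
    1 - Complex.exp (Complex.I * ξ * ((-x : ℝ) : ℂ)) -
      Complex.I * ξ * ((1 - Real.exp (-x) : ℝ) : ℂ) := by
  rw [levyKernel, map_add, map_sub, map_one, ← Complex.exp_conj, map_mul, map_mul, map_mul,
    map_mul, Complex.conj_I, Complex.conj_ofReal, Complex.conj_ofReal, Complex.conj_ofReal]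
  push_cast
  ring_nf

/-- Let `α, γ ≥ 0`, `β ∈ ℝ`, and let `ν` be a nonnegative measurable
Lévy density on `ℝ ∖ {0}` with `∫ min(1, x²) ν(x) dx < ∞` such that `ν(x)` and `ν(−x)`
are completely monotone on `(0, ∞)`. Then the Lévy–Khintchine exponent
`Ψ(ξ) = α ξ² − i β ξ + γ + ∫ (1 − e^{iξx} + iξ(1 − e^{−|x|}) sign x) ν(x) dx`
extends to a Rogers function. -/
theorem statement4 (α β γ : ℝ) (hα : 0 ≤ α) (hγ : 0 ≤ γ)
    (ν : ℝ → ℝ) (hmeas : Measurable ν) (hpos : ∀ x : ℝ, x ≠ 0 → 0 ≤ ν x)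
    (hint : IntegrableOn (fun x : ℝ => min 1 (x ^ 2) * ν x) (({0} : Set ℝ)ᶜ))
    (hcm₁ : CompletelyMonotoneOn ν)
    (hcm₂ : CompletelyMonotoneOn (fun x : ℝ => ν (-x))) :
    ExtendsToRogersFunction (fun ξ : ℝ =>
      (α : ℂ) * (ξ : ℂ) ^ 2 - Complex.I * (β : ℂ) * (ξ : ℂ) + (γ : ℂ) +
        ∫ x in (({0} : Set ℝ)ᶜ),
          (1 - Complex.exp (Complex.I * (ξ : ℂ) * (x : ℂ))
            + Complex.I * (ξ : ℂ) * ((1 - Real.exp (-|x|) : ℝ) : ℂ) * (Real.sign x : ℂ))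
            * ((ν x : ℝ) : ℂ)) := by
  have hintpos : IntegrableOn (fun x : ℝ => min 1 (x ^ 2) * ν x) (Ioi 0) :=
    hint.mono_set fun x hx => ne_of_gt hx
  have hintneg : IntegrableOn (fun x : ℝ => min 1 (x ^ 2) * ν (-x)) (Ioi 0) := by
    have h : IntegrableOn (fun x : ℝ => min 1 (x ^ 2) * ν x) (Iio (-0)) :=
      hint.mono_set fun x hx => ne_of_lt (by simpa using hx)
    simpa using h.comp_neg_Ioi
  have hmeas' : Measurable fun x => ν (-x) := hmeas.comp measurable_neg
  obtain ⟨F, hF, hFΨ⟩ := ((extendsToRogersFunction_quadratic β hα hγ).add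
    (hcm₁.hasRogersRepresentation hmeas hintpos).extendsToRogersFunction).add
    (hcm₂.hasRogersRepresentation hmeas' hintneg).extendsToRogersFunction.conj
  refine ⟨F, hF, fun ξ hξ => ?_⟩
  refine (hFΨ ξ hξ).trans ((add_assoc _ _ _).trans ?_)
  congr 1
  set k : ℝ → ℂ := fun x => (1 - Complex.exp (Complex.I * (ξ : ℂ) * (x : ℂ))
    + Complex.I * (ξ : ℂ) * ((1 - Real.exp (-|x|) : ℝ) : ℂ) * (Real.sign x : ℂ)) * ((ν x : ℝ) : ℂ)
    with hk
  have hkpos : ∀ x ∈ Ioi (0 : ℝ), levyKernel ξ x * (ν x : ℂ) = k x := fun x hx => by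
    simp only [hk, levyKernel, abs_of_pos (show 0 < x from hx), Real.sign_of_pos hx]
    push_cast
    ring
  have hkneg : ∀ x ∈ Ioi (0 : ℝ),
      (starRingEnd ℂ) (levyKernel ξ x * (ν (-x) : ℂ)) = k (-x) := fun x hx => by
    have hx' : -x < 0 := neg_lt_zero.2 hx
    rw [map_mul, conj_levyKernel, Complex.conj_ofReal]
    simp only [hk, abs_neg, abs_of_pos (show 0 < x from hx), Real.sign_of_neg hx']
    push_cast
    ring
  have hiop : IntegrableOn k (Ioi 0) :=
    (integrableOn_levyKernel_mul hmeas (fun x hx => hpos x hx.ne') hintpos hξ).congr_fun hkpos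
      measurableSet_Ioi
  have hion : IntegrableOn (fun x => k (-x)) (Ioi 0) := by
    have h := integrableOn_levyKernel_mul hmeas'
      (fun x hx => hpos (-x) (neg_ne_zero.2 hx.ne')) hintneg hξ
    have h' : IntegrableOn (fun x => (starRingEnd ℂ) (levyKernel ξ x * (ν (-x) : ℂ))) (Ioi 0) :=
      Complex.conjLIE.toContinuousLinearEquiv.toContinuousLinearMap.integrable_comp h
    exact h'.congr_fun hkneg measurableSet_Ioi
  have hiin : IntegrableOn k (Iio 0) := by
    have h : IntegrableOn (fun x => k (-x)) (Ioi (-0)) := by simpa using hion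
    simpa using h.comp_neg_Iio
  have hset : ({0} : Set ℝ)ᶜ = Iio 0 ∪ Ioi 0 := (Iio_union_Ioi).symm
  have hneg : ∫ x in Iio (0 : ℝ), k x = (starRingEnd ℂ) (levyIntegral (fun x => ν (-x)) ξ) := by
    rw [levyIntegral, ← integral_conj, setIntegral_congr_fun measurableSet_Ioi hkneg,
      integral_comp_neg_Ioi, neg_zero, integral_Iic_eq_integral_Iio]
  have hdisj : Disjoint (Iio (0 : ℝ)) (Ioi 0) :=
    Set.disjoint_left.2 fun _ hx hx' => lt_asymm (mem_Iio.1 hx) (mem_Ioi.1 hx')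
  rw [hset, setIntegral_union hdisj measurableSet_Ioi hiin hiop, hneg, add_comm]
  congr 1
  exact setIntegral_congr_fun measurableSet_Ioi hkpos
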